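/- Fix p ∈ (0,1), α with 0 < α < 1/(1+p), a grading exponent q > 2/α, and set β = α − 2/q ∈ (0,1). For each n ≥ 1 let π_h be the piecewise-constant mean-value projection on the graded mesh with nodes t_i = (i/n)^q. Then there is a constant C, independent of n and u, such that for every u ∈ C⁴_α the function w = K(I − π_h)u satisfies ‖w‖_{4,β} ≤ C·n^{−2}·‖u‖_{4,α}. -/

import Mathlib

open MeasureTheory Real

/-- The double-layer corner kernel
`k(x,y) = (sin(pπ)/π)·x/(x² + y² + 2xy·cos(pπ))` for a corner of interior angle
`(1−p)π`. -/
noncomputable def cornerKernel (p x y : ℝ) : ℝ :=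
  Real.sin (p * Real.pi) / Real.pi * x / (x ^ 2 + y ^ 2 + 2 * x * y * Real.cos (p * Real.pi))

/-- The corner operator `(Ku)(x) = ∫₀¹ k(x,y)·u(y) dy`. -/
noncomputable def cornerOp (p : ℝ) (u : ℝ → ℝ) (x : ℝ) : ℝ :=
  ∫ y in Set.Ioc (0 : ℝ) 1, cornerKernel p x y * u y

/-- Node `t_i = (i/n)^q` of the graded mesh on `[0,1]` with grading exponent `q`. -/
noncomputable def gradedNode (n : ℕ) (q : ℝ) (i : ℕ) : ℝ :=
  ((i : ℝ) / (n : ℝ)) ^ q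

/-- The piecewise-constant mean-value (Galerkin) projection `π_h` on the graded mesh:
on each subinterval `τ_i = (t_{i−1}, t_i]` the function is replaced by its mean value. -/
noncomputable def gradedProj (n : ℕ) (q : ℝ) (u : ℝ → ℝ) (x : ℝ) : ℝ :=
  ∑ i ∈ Finset.Icc 1 n,
    Set.indicator (Set.Ioc (gradedNode n q (i - 1)) (gradedNode n q i))
      (fun _ => (gradedNode n q i - gradedNode n q (i - 1))⁻¹ *
        ∫ y in Set.Ioc (gradedNode n q (i - 1)) (gradedNode n q i), u y) x

/-- The set of weighted values whose supremum is the weighted norm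
`‖u‖_{m,α} = max_{0≤i≤m} sup_{t∈(0,1]} t^{max(i−α,0)}·|u^{(i)}(t)|`, with derivatives
taken within `(0,1]`. -/
def weightedSet (m : ℕ) (α : ℝ) (u : ℝ → ℝ) : Set ℝ :=
  {r : ℝ | ∃ i ≤ m, ∃ t ∈ Set.Ioc (0 : ℝ) 1,
    r = t ^ max ((i : ℝ) - α) 0 * |iteratedDerivWithin i u (Set.Ioc 0 1) t|}

/-- The weighted norm `‖u‖_{m,α}`. -/
noncomputable def weightedNorm (m : ℕ) (α : ℝ) (u : ℝ → ℝ) : ℝ :=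
  sSup (weightedSet m α u)

/-- `K(I − π_h)u`, the corner operator applied to the projection error of `u`. -/
noncomputable def cornerErr (p q : ℝ) (n : ℕ) (u : ℝ → ℝ) : ℝ → ℝ :=
  fun x => cornerOp p (fun y => u y - gradedProj n q u y) x

/-- complex-kernel imaginary part -/
noncomputable def Kr (ω : ℂ) (i : ℕ) (x y : ℝ) : ℝ :=
  (ω * (((x : ℂ) + y * ω) ^ (i + 1))⁻¹).im

structure GoodW (ω : ℂ) (κ : ℝ) : Prop where
  pos : 0 < κ
  nrm : ‖ω‖ = 1
  low : ∀ x y : ℝ, 0 ≤ x → 0 ≤ y → κ * (x + y) ≤ ‖(x : ℂ) + y * ω‖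

theorem GoodW.ne {ω : ℂ} {κ : ℝ} (h : GoodW ω κ) {x y : ℝ} (hx : 0 < x) (hy : 0 ≤ y) :
    (x : ℂ) + y * ω ≠ 0 := by
  intro h0
  have h1 := h.low x y hx.le hy
  rw [h0, norm_zero] at h1
  have := mul_pos h.pos (by linarith : 0 < x + y)
  linarith

theorem GoodW.inv_le {ω : ℂ} {κ : ℝ} (h : GoodW ω κ) {x y : ℝ} (hx : 0 < x) (hy : 0 ≤ y) (i : ℕ) :
    ‖(((x : ℂ) + y * ω) ^ i)⁻¹‖ ≤ ((κ * (x + y)) ^ i)⁻¹ := by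
  rw [norm_inv, norm_pow]
  have := mul_pos h.pos (by linarith : 0 < x + y)
  have h1 := h.low x y hx.le hy
  gcongr

theorem Kr_abs {ω : ℂ} {κ : ℝ} (h : GoodW ω κ) {x y : ℝ} (hx : 0 < x) (hy : 0 ≤ y) (i : ℕ) :
    |Kr ω i x y| ≤ ((κ * (x + y)) ^ (i + 1))⁻¹ := by
  unfold Kr
  refine (Complex.abs_im_le_norm _).trans ?_
  rw [norm_mul, h.nrm, one_mul]
  exact h.inv_le hx hy _

theorem Kr_hasDerivAt {ω : ℂ} {κ : ℝ} (h : GoodW ω κ) {x y : ℝ} (hx : 0 < x) (hy : 0 ≤ y) (i : ℕ) :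
    HasDerivAt (fun x => Kr ω i x y) (-((i : ℝ) + 1) * Kr ω (i + 1) x y) x := by
  have h1 : HasDerivAt (fun x : ℝ => (x : ℂ) + y * ω) 1 x :=
    (Complex.ofRealCLM.hasDerivAt (x := x)).add_const _
  have hne := h.ne hx hy
  have h2 := (((h1.pow (i + 1)).fun_inv (pow_ne_zero _ hne)).const_mul ω)
  have h3 := Complex.imCLM.hasFDerivAt.comp_hasDerivAt x h2
  refine h3.congr_deriv ?_
  unfold Kr
  have : ω * (-(((i + 1 : ℕ) : ℂ) * ((x : ℂ) + y * ω) ^ (i + 1 - 1) * 1) / (((x : ℂ) + y * ω) ^ (i + 1)) ^ 2)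
    = ((-((i : ℝ) + 1) : ℝ) : ℂ) * (ω * (((x : ℂ) + y * ω) ^ (i + 1 + 1))⁻¹) := by
    push_cast
    generalize (x : ℂ) + y * ω = Z at hne
    field_simp
    ring
  simp only [Complex.imCLM_apply]
  simp only [Pi.pow_apply]
  rw [this, Complex.im_ofReal_mul]

theorem Kr_hasDerivAt_y {ω : ℂ} {κ : ℝ} (h : GoodW ω κ) {x y : ℝ} (hx : 0 < x) (hy : 0 ≤ y) (i : ℕ) :
    HasDerivAt (fun y : ℝ => ((((x : ℂ) + y * ω) ^ i)⁻¹))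
      (-(i : ℂ) * ω * (((x : ℂ) + y * ω) ^ (i + 1))⁻¹) y := by
  have h1 : HasDerivAt (fun y : ℝ => (x : ℂ) + y * ω) (1 * ω) y :=
    ((Complex.ofRealCLM.hasDerivAt (x := y)).mul_const ω).const_add _
  have hne := h.ne hx hy
  have h2 := ((h1.pow i).fun_inv (pow_ne_zero _ hne))
  refine h2.congr_deriv ?_
  rcases i with _ | i
  · simp
  · simp only [Nat.add_sub_cancel, Pi.pow_apply]
    field_simp
    ring

theorem Kr_lip {ω : ℂ} {κ : ℝ} (h : GoodW ω κ) {x t y : ℝ} (hx : 0 < x) (ht : 0 ≤ t) (hty : t ≤ y)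
    (i : ℕ) : |Kr ω i x y - Kr ω i x t| ≤ ((i : ℝ) + 1) * ((κ * (x + t)) ^ (i + 2))⁻¹ * (y - t) := by
  have key : ‖(((x : ℂ) + y * ω) ^ (i + 1))⁻¹ - (((x : ℂ) + t * ω) ^ (i + 1))⁻¹‖ ≤
      ((i : ℝ) + 1) * ((κ * (x + t)) ^ (i + 2))⁻¹ * ‖y - t‖ := by
    refine Convex.norm_image_sub_le_of_norm_hasDerivWithin_le (s := Set.Icc t y)
      (f := fun y : ℝ => ((((x : ℂ) + y * ω) ^ (i + 1))⁻¹))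
      (f' := fun y : ℝ => (-((i + 1 : ℕ) : ℂ) * ω * (((x : ℂ) + y * ω) ^ (i + 1 + 1))⁻¹)) ?_ ?_
      (convex_Icc t y) (Set.left_mem_Icc.2 hty) (Set.right_mem_Icc.2 hty)
    · intro z hz
      exact (Kr_hasDerivAt_y h hx (ht.trans hz.1) (i + 1)).hasDerivWithinAt
    · intro z hz
      rw [norm_mul, norm_mul, norm_neg, h.nrm, mul_one, Complex.norm_natCast]
      push_cast
      have h1 := h.inv_le hx (ht.trans hz.1) (i + 1 + 1)
      have h2 := mul_pos h.pos (by linarith : 0 < x + t)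
      have h3 : κ * (x + t) ≤ κ * (x + z) := by
        have := h.pos
        have := hz.1
        gcongr
      refine mul_le_mul_of_nonneg_left (h1.trans ?_) (by positivity)
      show ((κ * (x + z)) ^ (i + 2))⁻¹ ≤ _
      gcongr
  unfold Kr
  rw [← Complex.sub_im, ← mul_sub]
  refine (Complex.abs_im_le_norm _).trans ?_
  rw [norm_mul, h.nrm, one_mul]
  rwa [Real.norm_of_nonneg (by linarith)] at key

theorem Kr_cont {ω : ℂ} {κ : ℝ} (h : GoodW ω κ) {x : ℝ} (hx : 0 < x) (i : ℕ) :
    ContinuousOn (fun y => Kr ω i x y) (Set.Ici 0) := by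
  unfold Kr
  refine Complex.continuous_im.comp_continuousOn (ContinuousOn.mul continuousOn_const ?_)
  refine ContinuousOn.inv₀ (by fun_prop) ?_
  intro y hy
  exact pow_ne_zero _ (h.ne hx hy)

theorem Kr_int {ω : ℂ} {κ : ℝ} (h : GoodW ω κ) {x T : ℝ} (hx : 0 < x) (hT : 0 < T) (i : ℕ)
    (hi : 1 ≤ i) : |∫ y in (0 : ℝ)..T, Kr ω i x y| ≤ ((κ * T) ^ i)⁻¹ := by
  have hi' : (i : ℝ) ≠ 0 := by positivity
  have h1 : ∫ y in (0 : ℝ)..T, Kr ω i x y =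
      (-(i : ℝ)⁻¹ * ((((x : ℂ) + T * ω) ^ i)⁻¹).im) - (-(i : ℝ)⁻¹ * ((((x : ℂ) + (0 : ℝ) * ω) ^ i)⁻¹).im) := by
    refine intervalIntegral.integral_eq_sub_of_hasDerivAt
      (f := fun y : ℝ => (-(i : ℝ)⁻¹ * ((((x : ℂ) + y * ω) ^ i)⁻¹).im)) ?_ ?_
    · intro y hy
      rw [Set.uIcc_of_le hT.le] at hy
      have h3 := (Complex.imCLM.hasFDerivAt.comp_hasDerivAt y (Kr_hasDerivAt_y h hx hy.1 i)).const_mul (-(i : ℝ)⁻¹)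
      refine h3.congr_deriv ?_
      unfold Kr
      simp only [Complex.imCLM_apply]
      have : -(i : ℂ) * ω * (((x : ℂ) + y * ω) ^ (i + 1))⁻¹ = ((-(i : ℝ) : ℝ) : ℂ) * (ω * (((x : ℂ) + y * ω) ^ (i + 1))⁻¹) := by
        push_cast; ring
      rw [this, Complex.im_ofReal_mul]
      field_simp
    · refine ContinuousOn.intervalIntegrable ((Kr_cont h hx i).mono ?_)
      rw [Set.uIcc_of_le hT.le]
      exact fun y hy => hy.1
  have h2 : ((((x : ℂ) + (0 : ℝ) * ω) ^ i)⁻¹).im = 0 := by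
    have : (((x : ℂ) + (0 : ℝ) * ω) ^ i)⁻¹ = (((x ^ i)⁻¹ : ℝ) : ℂ) := by push_cast; simp
    rw [this, Complex.ofReal_im]
  rw [h1, h2, mul_zero, sub_zero, abs_mul]
  have h4 := h.inv_le hx hT.le i
  have h5 : ((κ * (x + T)) ^ i)⁻¹ ≤ ((κ * T) ^ i)⁻¹ := by
    have := h.pos
    gcongr
    linarith
  have h6 : |-(i : ℝ)⁻¹| ≤ 1 := by
    rw [abs_neg, abs_of_nonneg (by positivity)]
    exact inv_le_one_of_one_le₀ (by exact_mod_cast hi)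
  calc _ ≤ 1 * |((((x : ℂ) + T * ω) ^ i)⁻¹).im| := by gcongr
    _ ≤ _ := by rw [one_mul]; exact (Complex.abs_im_le_norm _).trans (h4.trans h5)

theorem goodW_of (p : ℝ) (hp0 : 0 < p) (hp1 : p < 1) :
    GoodW ⟨Real.cos (p * Real.pi), Real.sin (p * Real.pi)⟩ (Real.sqrt ((1 + Real.cos (p * Real.pi)) / 2)) := by
  have hpi := Real.pi_pos
  have hc : -1 < Real.cos (p * Real.pi) := by
    rw [← Real.cos_pi]
    exact Real.cos_lt_cos_of_nonneg_of_le_pi (by positivity) le_rfl (by nlinarith)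
  have hc1 := Real.cos_le_one (p * Real.pi)
  have hs := Real.sin_sq_add_cos_sq (p * Real.pi)
  refine ⟨Real.sqrt_pos.2 (by linarith), ?_, ?_⟩
  · rw [Complex.norm_eq_sqrt_sq_add_sq]
    simp only
    rw [add_comm, hs, Real.sqrt_one]
  · intro x y hx hy
    rw [Complex.norm_eq_sqrt_sq_add_sq]
    apply Real.le_sqrt_of_sq_le
    rw [mul_pow, Real.sq_sqrt (by linarith)]
    simp
    have e : (x + y * Real.cos (p * Real.pi)) ^ 2 + (y * Real.sin (p * Real.pi)) ^ 2 = x ^ 2 + y ^ 2 + 2 * x * y * Real.cos (p * Real.pi) := by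
      linear_combination y ^ 2 * hs
    rw [e]
    nlinarith [mul_nonneg (by linarith : 0 ≤ 1 - Real.cos (p * Real.pi)) (sq_nonneg (x - y))]

theorem cornerKernel_eq (p x y : ℝ) (hp0 : 0 < p) (hp1 : p < 1) (hx : 0 < x) (hy : 0 ≤ y) :
    cornerKernel p x y = Real.pi⁻¹ * Kr ⟨Real.cos (p * Real.pi), Real.sin (p * Real.pi)⟩ 0 x y := by
  unfold cornerKernel Kr
  have hs := Real.sin_sq_add_cos_sq (p * Real.pi)
  rw [zero_add, pow_one]
  simp [Complex.mul_im, Complex.inv_re, Complex.inv_im, Complex.normSq_apply]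
  have : (x + y * Real.cos (p * Real.pi)) * (x + y * Real.cos (p * Real.pi)) +
        y * Real.sin (p * Real.pi) * (y * Real.sin (p * Real.pi)) = x ^ 2 + y ^ 2 + 2 * x * y * Real.cos (p * Real.pi) := by
    linear_combination y ^ 2 * hs
  rw [this]
  ring

theorem Kr_zero_abs {p : ℝ} (hp0 : 0 < p) (hp1 : p < 1) {x y : ℝ} (hx : 0 < x) (hy : 0 ≤ y) :
    |Kr ⟨Real.cos (p * Real.pi), Real.sin (p * Real.pi)⟩ 0 x y| ≤
      2 / (1 + Real.cos (p * Real.pi)) * x * (x + y) ^ (-2 : ℝ) := by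
  have h := goodW_of p hp0 hp1
  have hk := Real.sqrt_pos.1 h.pos
  have e := cornerKernel_eq p x y hp0 hp1 hx hy
  have hpi := Real.pi_pos
  have : Kr ⟨Real.cos (p * Real.pi), Real.sin (p * Real.pi)⟩ 0 x y = Real.sin (p * Real.pi) * x / (x ^ 2 + y ^ 2 + 2 * x * y * Real.cos (p * Real.pi)) := by
    unfold cornerKernel at e
    field_simp at e
    rw [← e]
    ring_nf
  rw [this]
  have hxy : 0 < x + y := by linarith
  have hD : (1 + Real.cos (p * Real.pi)) / 2 * (x + y) ^ 2 ≤ x ^ 2 + y ^ 2 + 2 * x * y * Real.cos (p * Real.pi) := by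
    have hc1 := Real.cos_le_one (p * Real.pi)
    nlinarith [mul_nonneg (by linarith : 0 ≤ 1 - Real.cos (p * Real.pi)) (sq_nonneg (x - y))]
  have hpos : 0 < (1 + Real.cos (p * Real.pi)) / 2 * (x + y) ^ 2 := by positivity
  rw [abs_div, abs_mul, abs_of_pos hx, abs_of_pos (hpos.trans_le hD)]
  have h1 := Real.abs_sin_le_one (p * Real.pi)
  calc _ ≤ 1 * x / ((1 + Real.cos (p * Real.pi)) / 2 * (x + y) ^ 2) := by gcongr
    _ = _ := by
      rw [Real.rpow_neg hxy.le, show (2 : ℝ) = ((2 : ℕ) : ℝ) by norm_num, Real.rpow_natCast]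
      have : 0 < 1 + Real.cos (p * Real.pi) := by linarith
      push_cast
      field_simp

theorem rpow_int_eq {x a b r : ℝ} (hx : 0 < x) (ha : 0 ≤ a) (hab : a ≤ b) (hr : r ≠ -1) :
    ∫ y in a..b, (x + y) ^ r = ((x + b) ^ (r + 1) - (x + a) ^ (r + 1)) / (r + 1) := by
  rw [intervalIntegral.integral_comp_add_left (fun z => z ^ r)]
  rw [integral_rpow]
  right
  refine ⟨hr, ?_⟩
  rw [Set.uIcc_of_le (by linarith)]
  intro h
  have := h.1
  linarith

theorem rpow_cont {x r : ℝ} (hx : 0 < x) : ContinuousOn (fun y : ℝ => (x + y) ^ r) (Set.Ici 0) := by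
  refine ContinuousOn.rpow_const (by fun_prop) ?_
  intro y hy
  left
  have : 0 ≤ y := hy
  linarith

theorem rpow_ii {x a b r : ℝ} (hx : 0 < x) (ha : 0 ≤ a) (hab : a ≤ b) :
    IntervalIntegrable (fun y : ℝ => (x + y) ^ r) volume a b := by
  refine ContinuousOn.intervalIntegrable ((rpow_cont hx).mono ?_)
  rw [Set.uIcc_of_le hab]
  exact fun y hy => ha.trans hy.1

theorem rpow_int_le {x a b r : ℝ} (hx : 0 < x) (ha : 0 ≤ a) (hab : a ≤ b) (hr : r < -1) :
    ∫ y in a..b, (x + y) ^ r ≤ x ^ (r + 1) / (-(r + 1)) := by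
  rw [rpow_int_eq hx ha hab hr.ne]
  rw [← neg_div_neg_eq]
  have h1 : 0 ≤ (x + b) ^ (r + 1) := Real.rpow_nonneg (by linarith) _
  have h2 : (x + a) ^ (r + 1) ≤ x ^ (r + 1) :=
    Real.rpow_le_rpow_of_nonpos hx (by linarith) (by linarith)
  have : 0 < -(r + 1) := by linarith
  gcongr
  linarith

theorem rpow_int_le' {x a β : ℝ} (hx : 0 < x) (hx1 : x ≤ 1) (ha : 0 ≤ a) (hab : a ≤ 1) (h0 : 0 < β)
    (h1 : β < 1) : ∫ y in a..1, (x + y) ^ (β - 1) ≤ 2 / β := by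
  rw [rpow_int_eq hx ha hab (by linarith), sub_add_cancel]
  have h3 : 0 ≤ (x + a) ^ β := Real.rpow_nonneg (by linarith) _
  have h2 : (x + 1) ^ β ≤ 2 := by
    calc (x + 1) ^ β ≤ 2 ^ β := Real.rpow_le_rpow (by linarith) (by linarith) h0.le
      _ ≤ 2 ^ (1 : ℝ) := Real.rpow_le_rpow_of_exponent_le (by norm_num) h1.le
      _ = 2 := by norm_num
  gcongr
  linarith

theorem avg_bound {u : ℝ → ℝ} {a b c B : ℝ} (hab : a < b)
    (hu : IntegrableOn u (Set.Ioc a b)) (h : ∀ z ∈ Set.Ioc a b, |c - u z| ≤ B) :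
    |c - (b - a)⁻¹ * ∫ y in Set.Ioc a b, u y| ≤ B := by
  have hba : 0 < b - a := by linarith
  have h1 : ∫ y in Set.Ioc a b, (c - u y) = (b - a) * c - ∫ y in Set.Ioc a b, u y := by
    rw [integral_sub (by simp) hu]
    simp [hab.le]
  have h2 : |∫ y in Set.Ioc a b, (c - u y)| ≤ B * (b - a) := by
    have := norm_setIntegral_le_of_norm_le_const (μ := volume) (s := Set.Ioc a b) (f := fun y => c - u y) (C := B)
      (by simp) (by simpa using h)
    simpa [hab.le] using this
  rw [h1] at h2
  have : c - (b - a)⁻¹ * ∫ y in Set.Ioc a b, u y = (b - a)⁻¹ * ((b - a) * c - ∫ y in Set.Ioc a b, u y) := by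
    field_simp
  rw [this, abs_mul, abs_of_pos (inv_pos.2 hba), inv_mul_le_iff₀ hba, mul_comm (b - a) B]
  exact h2

theorem u_holder {u : ℝ → ℝ} {α M : ℝ} (hα : 0 < α) (hu : ContDiffOn ℝ 4 u (Set.Ioc 0 1))
    (hd : ∀ t ∈ Set.Ioo (0 : ℝ) 1, |deriv u t| ≤ M * t ^ (α - 1)) {y z : ℝ}
    (hz : 0 < z) (hzy : z ≤ y) (hy : y ≤ 1) : |u y - u z| ≤ M / α * (y ^ α - z ^ α) := by
  have hdiff : ∀ t ∈ Set.Ioo (0 : ℝ) 1, HasDerivAt u (deriv u t) t := by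
    intro t ht
    have : DifferentiableWithinAt ℝ u (Set.Ioc 0 1) t :=
      (hu.differentiableOn (by norm_num)) t ⟨ht.1, ht.2.le⟩
    exact (this.differentiableAt (Ioc_mem_nhds ht.1 ht.2)).hasDerivAt
  have hpd : ∀ t ∈ Set.Ioo (0 : ℝ) 1, HasDerivAt (fun t => M / α * t ^ α) (M * t ^ (α - 1)) t := by
    intro t ht
    refine ((Real.hasDerivAt_rpow_const (Or.inl ht.1.ne')).const_mul (M / α)).congr_deriv ?_
    field_simp
  have hpc : ContinuousOn (fun t : ℝ => M / α * t ^ α) (Set.Ioc 0 1) :=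
    continuousOn_const.mul (continuousOn_id.rpow_const (fun t _ => Or.inr hα.le))
  have mono1 : MonotoneOn (fun t => M / α * t ^ α - u t) (Set.Ioc 0 1) := by
    refine monotoneOn_of_hasDerivWithinAt_nonneg (convex_Ioc 0 1) (hpc.sub hu.continuousOn)
      (f' := fun t => M * t ^ (α - 1) - deriv u t) ?_ ?_
    · rw [interior_Ioc]
      intro t ht
      exact ((hpd t ht).sub (hdiff t ht)).hasDerivWithinAt
    · rw [interior_Ioc]
      intro t ht
      have := abs_le.1 (hd t ht)
      linarith
  have mono2 : MonotoneOn (fun t => M / α * t ^ α + u t) (Set.Ioc 0 1) := by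
    refine monotoneOn_of_hasDerivWithinAt_nonneg (convex_Ioc 0 1) (hpc.add hu.continuousOn)
      (f' := fun t => M * t ^ (α - 1) + deriv u t) ?_ ?_
    · rw [interior_Ioc]
      intro t ht
      exact ((hpd t ht).add (hdiff t ht)).hasDerivWithinAt
    · rw [interior_Ioc]
      intro t ht
      have := abs_le.1 (hd t ht)
      linarith
  have m1 := mono1 ⟨hz, hzy.trans hy⟩ ⟨hz.trans_le hzy, hy⟩ hzy
  have m2 := mono2 ⟨hz, hzy.trans hy⟩ ⟨hz.trans_le hzy, hy⟩ hzy
  simp only at m1 m2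
  rw [abs_le]
  constructor <;> linarith

theorem u_holder' {u : ℝ → ℝ} {α M L : ℝ} (hα : 0 < α) (hM : 0 ≤ M) (hu : ContDiffOn ℝ 4 u (Set.Ioc 0 1))
    (hd : ∀ t ∈ Set.Ioo (0 : ℝ) 1, |deriv u t| ≤ M * t ^ (α - 1)) {y z : ℝ}
    (hz : 0 < z) (hz1 : z ≤ 1) (hy0 : 0 < y) (hy : y ≤ 1) (hyL : y ≤ L) (hzL : z ≤ L) :
    |u y - u z| ≤ M / α * L ^ α := by
  have h1 : y ^ α ≤ L ^ α := Real.rpow_le_rpow hy0.le hyL hα.le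
  have h2 : z ^ α ≤ L ^ α := Real.rpow_le_rpow hz.le hzL hα.le
  have h3 := Real.rpow_nonneg hy0.le α
  have h4 := Real.rpow_nonneg hz.le α
  rcases le_total z y with h | h
  · refine (u_holder hα hu hd hz h hy).trans ?_
    gcongr
    linarith
  · rw [abs_sub_comm]
    refine (u_holder hα hu hd hy0 h hz1).trans ?_
    gcongr
    linarith

theorem rpow_concave {a b α : ℝ} (ha : 0 < a) (hab : a ≤ b) (h0 : 0 < α) (h1 : α ≤ 1) :
    b ^ α - a ^ α ≤ α * a ^ (α - 1) * (b - a) := by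
  have h := rpow_one_add_le_one_add_mul_self (s := b / a - 1) (p := α)
    (by have : 0 ≤ b / a := div_nonneg (by linarith) ha.le
        linarith) h0.le h1
  rw [add_sub_cancel, Real.div_rpow (by linarith) ha.le] at h
  have hp := Real.rpow_pos_of_pos ha α
  rw [div_le_iff₀ hp] at h
  rw [Real.rpow_sub_one ha.ne']
  calc _ ≤ (1 + α * (b / a - 1)) * a ^ α - a ^ α := by linarith
    _ = _ := by field_simp; ring

theorem rpow_convex {a b q : ℝ} (hb : 0 < b) (ha : 0 ≤ a) (h1 : 1 ≤ q) :
    b ^ q - a ^ q ≤ q * b ^ (q - 1) * (b - a) := by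
  have h := one_add_mul_self_le_rpow_one_add (s := a / b - 1) (p := q)
    (by have : 0 ≤ a / b := div_nonneg (by linarith) hb.le
        linarith) h1
  rw [add_sub_cancel, Real.div_rpow ha hb.le] at h
  have hp := Real.rpow_pos_of_pos hb q
  rw [le_div_iff₀ hp] at h
  rw [Real.rpow_sub_one hb.ne']
  calc _ ≤ b ^ q - (1 + q * (a / b - 1)) * b ^ q := by linarith
    _ = _ := by field_simp; ring

theorem node_succ_le {n m : ℕ} {q : ℝ} (hm : 1 ≤ m) (hq : 0 ≤ q) :
    gradedNode n q (m + 1) ≤ 2 ^ q * gradedNode n q m := by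
  unfold gradedNode
  rw [← Real.mul_rpow (by norm_num) (by positivity)]
  refine Real.rpow_le_rpow (by positivity) ?_ hq
  rw [← mul_div_assoc]
  have : (1 : ℝ) ≤ m := by exact_mod_cast hm
  gcongr
  push_cast
  linarith

theorem node_step {n m : ℕ} {q : ℝ} (hn : 1 ≤ n) (hm : 1 ≤ m) (hq : 1 ≤ q) :
    gradedNode n q (m + 1) - gradedNode n q m ≤
      q * 2 ^ (q - 1) * ((m : ℝ) / n) ^ (q - 1) * (n : ℝ)⁻¹ := by
  unfold gradedNode
  have hn' : (0 : ℝ) < n := by exact_mod_cast hn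
  have hm' : (1 : ℝ) ≤ m := by exact_mod_cast hm
  have h := rpow_convex (a := (m : ℝ) / n) (b := ((m + 1 : ℕ) : ℝ) / n) (q := q) (by positivity) (by positivity) hq
  refine h.trans ?_
  have e : ((m + 1 : ℕ) : ℝ) / n - (m : ℝ) / n = (n : ℝ)⁻¹ := by
    push_cast; field_simp; ring
  rw [e, mul_assoc q (2 ^ (q - 1)), ← Real.mul_rpow (by norm_num) (by positivity)]
  have : ((m + 1 : ℕ) : ℝ) / n ≤ 2 * (m / n) := by
    rw [← mul_div_assoc]
    gcongr
    push_cast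
    linarith
  have h2 : (((m + 1 : ℕ) : ℝ) / n) ^ (q - 1) ≤ (2 * (m / n)) ^ (q - 1) :=
    Real.rpow_le_rpow (by positivity) this (by linarith)
  gcongr

theorem node_mono {n m : ℕ} {q : ℝ} (hn : 1 ≤ n) (hq : 0 < q) :
    gradedNode n q m < gradedNode n q (m + 1) := by
  unfold gradedNode
  have hn' : (0 : ℝ) < n := by exact_mod_cast hn
  refine Real.rpow_lt_rpow (by positivity) ?_ hq
  push_cast
  gcongr
  linarith

theorem node_nonneg {n m : ℕ} {q : ℝ} : 0 ≤ gradedNode n q m := by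
  unfold gradedNode
  positivity

theorem node_zero {n : ℕ} {q : ℝ} (hq : 0 < q) : gradedNode n q 0 = 0 := by
  unfold gradedNode
  simp [hq.ne']

theorem node_n {n : ℕ} {q : ℝ} (hn : 1 ≤ n) : gradedNode n q n = 1 := by
  unfold gradedNode
  rw [div_self (by positivity), Real.one_rpow]

theorem node_le {n : ℕ} {q : ℝ} (hn : 1 ≤ n) (hq : 0 < q) {a b : ℕ} (h : a ≤ b) :
    gradedNode n q a ≤ gradedNode n q b :=
  monotone_nat_of_le_succ (fun m => (node_mono (m := m) hn hq).le) h

theorem proj_eq {n : ℕ} {q : ℝ} {u : ℝ → ℝ} (hn : 1 ≤ n) (hq : 0 < q) {m : ℕ} (hm : m < n) {y : ℝ}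
    (hy : y ∈ Set.Ioc (gradedNode n q m) (gradedNode n q (m + 1))) :
    gradedProj n q u y = (gradedNode n q (m + 1) - gradedNode n q m)⁻¹ *
        ∫ y in Set.Ioc (gradedNode n q m) (gradedNode n q (m + 1)), u y := by
  unfold gradedProj
  rw [Finset.sum_eq_single (m + 1)]
  · rw [Set.indicator_of_mem (by simpa using hy)]
    simp
  · intro b hb hne
    rw [Set.indicator_of_notMem]
    intro hy2
    rw [Finset.mem_Icc] at hb
    rcases lt_or_gt_of_ne hne with h | h
    · have := node_le (q := q) hn hq (show b ≤ m by omega)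
      linarith [hy.1, hy2.2]
    · have := node_le (q := q) hn hq (show m + 1 ≤ b - 1 by omega)
      linarith [hy.2, hy2.1]
  · intro h
    exfalso
    apply h
    rw [Finset.mem_Icc]
    omega

theorem proj_integrable {n : ℕ} {q : ℝ} {u : ℝ → ℝ} (s : Set ℝ) (hs : volume s ≠ ⊤) :
    IntegrableOn (gradedProj n q u) s := by
  unfold gradedProj
  refine integrable_finsetSum _ (fun i _ => ?_)
  refine Integrable.indicator ?_ measurableSet_Ioc
  exact integrableOn_const hs

theorem first_zero {p : ℝ} (hp0 : 0 < p) (hp1 : p < 1) {x T B : ℝ} {v : ℝ → ℝ} (hx : 0 < x)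
    (hT : 0 < T) (hB : 0 ≤ B) (hv : ∀ y ∈ Set.Ioc 0 T, |v y| ≤ B) :
    |∫ y in (0 : ℝ)..T, Kr ⟨Real.cos (p * Real.pi), Real.sin (p * Real.pi)⟩ 0 x y * v y| ≤
      2 / (1 + Real.cos (p * Real.pi)) * B := by
  have h := goodW_of p hp0 hp1
  have hk : 0 < 1 + Real.cos (p * Real.pi) := by have := Real.sqrt_pos.1 h.pos; linarith
  have h1 := intervalIntegral.norm_integral_le_of_norm_le (a := 0) (b := T) (μ := volume)
    (f := fun y => Kr ⟨Real.cos (p * Real.pi), Real.sin (p * Real.pi)⟩ 0 x y * v y)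
    (g := fun y => (2 / (1 + Real.cos (p * Real.pi)) * x * B) * (x + y) ^ (-2 : ℝ)) hT.le
    (Filter.Eventually.of_forall (fun y hy => by
      rw [Real.norm_eq_abs, abs_mul]
      have e1 := Kr_zero_abs hp0 hp1 hx hy.1.le
      have e2 := hv y hy
      have e3 : 0 ≤ (x + y) ^ (-2 : ℝ) := Real.rpow_nonneg (by linarith [hy.1]) _
      calc _ ≤ (2 / (1 + Real.cos (p * Real.pi)) * x * (x + y) ^ (-2 : ℝ)) * B := by gcongr
        _ = _ := by ring))
    ((rpow_ii hx le_rfl hT.le).const_mul _)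
  rw [Real.norm_eq_abs, intervalIntegral.integral_const_mul] at h1
  have h2 := rpow_int_le (r := -2) hx le_rfl hT.le (by norm_num)
  refine h1.trans ?_
  calc _ ≤ (2 / (1 + Real.cos (p * Real.pi)) * x * B) * (x ^ (-2 + 1 : ℝ) / (-(-2 + 1))) := by gcongr
    _ = _ := by
      rw [show (-2 + 1 : ℝ) = -1 by norm_num, Real.rpow_neg_one]
      field_simp

theorem first_pos {ω : ℂ} {κ : ℝ} (h : GoodW ω κ) {x T α γ M c : ℝ} {u : ℝ → ℝ} (hx : 0 < x)
    (hT : 0 < T) (hα0 : 0 < α) (hα1 : α < 1) (hγ : 0 < γ) (hβ : 0 < α - γ) (hM : 0 ≤ M) {i : ℕ} (hi : 1 ≤ i)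
    (hui : IntegrableOn u (Set.Ioc 0 T))
    (hH : ∀ y z L : ℝ, 0 < y → y ≤ T → 0 < z → z ≤ T → y ≤ L → z ≤ L → |u y - u z| ≤ M / α * L ^ α)
    (hv : ∀ y ∈ Set.Ioc 0 T, |u y - c| ≤ M / α * T ^ α) :
    |∫ y in (0 : ℝ)..T, Kr ω i x y * (u y - c)| ≤
      ((κ ^ (i + 1))⁻¹ / (α * (i - α)) + (κ ^ i)⁻¹ / α + (κ ^ (i + 1))⁻¹ / α) * M * T ^ γ * x ^ (α - γ - i) := by
  have hκ := h.pos
  have hi' : (1 : ℝ) ≤ i := by exact_mod_cast hi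
  have hTγ := Real.rpow_pos_of_pos hT γ
  have hxb := Real.rpow_pos_of_pos hx (α - γ - i)
  have hia : 0 < (i : ℝ) - α := by linarith
  have hKb : ∀ y : ℝ, 0 ≤ y → |Kr ω i x y| ≤ (κ ^ (i + 1))⁻¹ * (x + y) ^ (-((i : ℝ) + 1)) := by
    intro y hy
    have := Kr_abs h hx hy i
    rw [mul_pow, mul_inv] at this
    rw [Real.rpow_neg (by linarith)]
    have e : (x + y) ^ ((i : ℝ) + 1) = (x + y) ^ (i + 1) := by
      rw [← Real.rpow_natCast]; push_cast; rfl
    rw [e]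
    exact this
  have hKi : IntervalIntegrable (fun y => Kr ω i x y) volume 0 T := by
    refine ContinuousOn.intervalIntegrable ((Kr_cont h hx i).mono ?_)
    rw [Set.uIcc_of_le hT.le]
    exact fun y hy => hy.1
  rcases le_or_gt x T with hxT | hxT
  · have hKu : IntervalIntegrable (fun y => Kr ω i x y * (u y - u x)) volume 0 T := by
      refine IntervalIntegrable.continuousOn_mul ?_ ((Kr_cont h hx i).mono ?_)
      · exact ((intervalIntegrable_iff_integrableOn_Ioc_of_le hT.le).2 hui).sub (by simp)
      · rw [Set.uIcc_of_le hT.le]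
        exact fun y hy => hy.1
    have split : ∫ y in (0 : ℝ)..T, Kr ω i x y * (u y - c) =
        (∫ y in (0 : ℝ)..T, Kr ω i x y * (u y - u x)) + (∫ y in (0 : ℝ)..T, Kr ω i x y) * (u x - c) := by
      rw [← intervalIntegral.integral_mul_const, ← intervalIntegral.integral_add hKu (hKi.mul_const _)]
      congr 1
      ext y
      ring
    have b1 : |∫ y in (0 : ℝ)..T, Kr ω i x y * (u y - u x)| ≤
        ((κ ^ (i + 1))⁻¹ * (M / α)) * (x ^ (α - i) / (i - α)) := by
      have h1 := intervalIntegral.norm_integral_le_of_norm_le (a := 0) (b := T) (μ := volume)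
        (f := fun y => Kr ω i x y * (u y - u x))
        (g := fun y => ((κ ^ (i + 1))⁻¹ * (M / α)) * (x + y) ^ (α - i - 1)) hT.le
        (Filter.Eventually.of_forall (fun y hy => by
          rw [Real.norm_eq_abs, abs_mul]
          have e1 := hKb y hy.1.le
          have e2 := hH y x (x + y) hy.1 hy.2 hx hxT (by linarith) (by linarith [hy.1])
          have hxy : 0 < x + y := by linarith [hy.1]
          calc _ ≤ ((κ ^ (i + 1))⁻¹ * (x + y) ^ (-((i : ℝ) + 1))) * (M / α * (x + y) ^ α) := by gcongr
            _ = ((κ ^ (i + 1))⁻¹ * (M / α)) * ((x + y) ^ (-((i : ℝ) + 1)) * (x + y) ^ α) := by ring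
            _ = _ := by
              rw [← Real.rpow_add hxy]
              congr 2
              ring))
        ((rpow_ii hx le_rfl hT.le).const_mul _)
      rw [Real.norm_eq_abs, intervalIntegral.integral_const_mul] at h1
      have h2 := rpow_int_le (r := α - i - 1) hx le_rfl hT.le (by linarith)
      rw [show α - (i : ℝ) - 1 + 1 = α - i by ring, show -(α - (i : ℝ)) = i - α by ring] at h2
      refine h1.trans ?_
      gcongr
    have b2 : |(∫ y in (0 : ℝ)..T, Kr ω i x y) * (u x - c)| ≤ ((κ ^ i)⁻¹ * (M / α)) * T ^ (α - i) := by
      rw [abs_mul]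
      have e1 := Kr_int h hx hT i hi
      have e2 := hv x ⟨hx, hxT⟩
      calc _ ≤ ((κ * T) ^ i)⁻¹ * (M / α * T ^ α) := by gcongr
        _ = _ := by
          rw [Real.rpow_sub hT, Real.rpow_natCast, mul_pow]
          field_simp
    have c1 : x ^ (α - i) ≤ T ^ γ * x ^ (α - γ - i) := by
      rw [show α - (i : ℝ) = γ + (α - γ - i) by ring, Real.rpow_add hx]
      have := Real.rpow_le_rpow hx.le hxT hγ.le
      gcongr
    have c2 : T ^ (α - i) ≤ T ^ γ * x ^ (α - γ - i) := by
      rw [show α - (i : ℝ) = γ + (α - γ - i) by ring, Real.rpow_add hT]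
      have := Real.rpow_le_rpow_of_nonpos hx hxT (show α - γ - i ≤ 0 by linarith)
      gcongr
    rw [split]
    refine (abs_add_le _ _).trans ((add_le_add b1 b2).trans ?_)
    calc _ ≤ ((κ ^ (i + 1))⁻¹ * (M / α)) * ((T ^ γ * x ^ (α - γ - i)) / (i - α)) +
          ((κ ^ i)⁻¹ * (M / α)) * (T ^ γ * x ^ (α - γ - i)) := by gcongr
      _ = ((κ ^ (i + 1))⁻¹ / (α * (i - α)) + (κ ^ i)⁻¹ / α) * M * T ^ γ * x ^ (α - γ - i) := by
        field_simp
      _ ≤ _ := by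
        have : 0 ≤ (κ ^ (i + 1))⁻¹ / α := by positivity
        refine mul_le_mul_of_nonneg_right (mul_le_mul_of_nonneg_right (mul_le_mul_of_nonneg_right ?_ hM) hTγ.le) hxb.le
        linarith
  · have h1 := intervalIntegral.norm_integral_le_of_norm_le_const (a := 0) (b := T)
        (f := fun y => Kr ω i x y * (u y - c))
        (C := (κ ^ (i + 1))⁻¹ * x ^ (-((i : ℝ) + 1)) * (M / α * T ^ α)) (by
          intro y hy
          rw [Set.uIoc_of_le hT.le] at hy
          rw [Real.norm_eq_abs, abs_mul]
          have e1 := hKb y hy.1.le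
          have e2 := hv y hy
          have e3 : (x + y) ^ (-((i : ℝ) + 1)) ≤ x ^ (-((i : ℝ) + 1)) :=
            Real.rpow_le_rpow_of_nonpos hx (by linarith [hy.1]) (by linarith)
          have e4 := Real.rpow_nonneg hx.le (-((i : ℝ) + 1))
          refine mul_le_mul (e1.trans ?_) e2 (abs_nonneg _) (by positivity)
          gcongr)
    rw [Real.norm_eq_abs, sub_zero, abs_of_pos hT] at h1
    refine h1.trans ?_
    have c1 : T ^ α * T ≤ T ^ γ * x ^ (α - γ + 1) := by
      have := Real.rpow_le_rpow hT.le hxT.le (show 0 ≤ α - γ + 1 by linarith)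
      calc T ^ α * T = T ^ γ * T ^ (α - γ + 1) := by
            rw [← Real.rpow_add hT, ← Real.rpow_add_one hT.ne']
            congr 1; ring
        _ ≤ _ := by gcongr
    have e4 := Real.rpow_nonneg hx.le (-((i : ℝ) + 1))
    calc _ = (κ ^ (i + 1))⁻¹ / α * M * (T ^ α * T) * x ^ (-((i : ℝ) + 1)) := by ring
      _ ≤ (κ ^ (i + 1))⁻¹ / α * M * (T ^ γ * x ^ (α - γ + 1)) * x ^ (-((i : ℝ) + 1)) := by gcongr
      _ = (κ ^ (i + 1))⁻¹ / α * M * T ^ γ * x ^ (α - γ - i) := by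
        have e : x ^ (α - γ - (i : ℝ)) = x ^ (α - γ + 1) * x ^ (-((i : ℝ) + 1)) := by
          rw [← Real.rpow_add hx]
          congr 1
          ring
        rw [e]
        simp only [mul_assoc]
      _ ≤ _ := by
        have : 0 ≤ (κ ^ (i + 1))⁻¹ / (α * (i - α)) + (κ ^ i)⁻¹ / α := by positivity
        refine mul_le_mul_of_nonneg_right (mul_le_mul_of_nonneg_right (mul_le_mul_of_nonneg_right ?_ hM) hTγ.le) hxb.le
        linarith

/-- constant for the remaining intervals -/
noncomputable def Cint (κ q β : ℝ) (i : ℕ) : ℝ :=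
  ((i : ℝ) + 1) * (κ ^ (i + 2))⁻¹ * (q * 2 ^ (q - 1)) ^ 2 * (2 ^ (-q)) ^ (β - 1 - i)

theorem other_interval {ω : ℂ} {κ : ℝ} (h : GoodW ω κ) {x α q M : ℝ} {u : ℝ → ℝ} (hx : 0 < x)
    (hα0 : 0 < α) (hα1 : α < 1) (hq : 1 ≤ q) (hβ : 0 < α - 2 / q) (hM : 0 ≤ M) (i : ℕ)
    {n m : ℕ} (hn : 1 ≤ n) (hm : 1 ≤ m) (hmn : m < n)
    (hui : IntegrableOn u (Set.Ioc 0 1))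
    (hH : ∀ y z : ℝ, 0 < z → z ≤ y → y ≤ 1 → |u y - u z| ≤ M / α * (y ^ α - z ^ α)) :
    |∫ y in (gradedNode n q m)..(gradedNode n q (m + 1)), Kr ω i x y * (u y - gradedProj n q u y)| ≤
      Cint κ q (α - 2 / q) i * M * ((n : ℝ) ^ 2)⁻¹ *
        ∫ y in (gradedNode n q m)..(gradedNode n q (m + 1)), (x + y) ^ (α - 2 / q - 1 - i) := by
  have hκ := h.pos
  have hn' : (0 : ℝ) < n := by exact_mod_cast hn
  have hm' : (0 : ℝ) < m := by exact_mod_cast hm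
  have hq0 : 0 < q := by linarith
  set a : ℝ := (m : ℝ) / n with ha_def
  have ha : 0 < a := by positivity
  set t := gradedNode n q m with ht_def
  set s := gradedNode n q (m + 1) with hs_def
  have hta : t = a ^ q := rfl
  have ht : 0 < t := Real.rpow_pos_of_pos ha q
  have hts : t < s := node_mono hn hq0
  have hs1 : s ≤ 1 := by
    rw [← node_n (q := q) hn]
    exact node_le hn hq0 hmn
  have hs2 : s ≤ 2 ^ q * t := node_succ_le hm hq0.le
  set P := q * 2 ^ (q - 1) * a ^ (q - 1) * (n : ℝ)⁻¹ with hP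
  have hP0 : 0 ≤ P := by positivity
  have hstep : s - t ≤ P := node_step hn hm hq
  have hsub : Set.Ioc t s ⊆ Set.Ioc 0 1 := fun y hy => ⟨ht.trans hy.1, hy.2.trans hs1⟩
  have hui' : IntegrableOn u (Set.Ioc t s) := hui.mono_set hsub
  set c := (s - t)⁻¹ * ∫ y in Set.Ioc t s, u y with hc
  have hpe : ∀ y ∈ Set.Ioc t s, gradedProj n q u y = c := fun y hy => proj_eq hn hq0 hmn hy
  have hvb : ∀ y ∈ Set.Ioc t s, |u y - c| ≤ M * t ^ (α - 1) * P := by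
    intro y hy
    refine avg_bound hts hui' (fun z hz => ?_)
    have hmain : ∀ y z, y ∈ Set.Ioc t s → z ∈ Set.Ioc t s → z ≤ y → |u y - u z| ≤ M * t ^ (α - 1) * P := by
      intro y z hy hz hzy
      refine (hH y z (ht.trans hz.1) hzy (hy.2.trans hs1)).trans ?_
      have e1 : y ^ α ≤ s ^ α := Real.rpow_le_rpow (ht.trans hy.1).le hy.2 hα0.le
      have e2 : t ^ α ≤ z ^ α := Real.rpow_le_rpow ht.le hz.1.le hα0.le
      have e3 := rpow_concave ht hts.le hα0 hα1.le
      have e4 := Real.rpow_nonneg ht.le (α - 1)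
      calc _ ≤ M / α * (α * t ^ (α - 1) * P) := by
            have : α * t ^ (α - 1) * (s - t) ≤ α * t ^ (α - 1) * P := by gcongr
            gcongr
            linarith
        _ = _ := by field_simp
    rcases le_total z y with hzy | hzy
    · exact hmain y z hy hz hzy
    · rw [abs_sub_comm]
      exact hmain z y hz hy hzy
  have hKc : ContinuousOn (fun y => Kr ω i x y) (Set.uIcc t s) := by
    refine (Kr_cont h hx i).mono ?_
    rw [Set.uIcc_of_le hts.le]
    exact fun y hy => ht.le.trans hy.1
  have huI : IntervalIntegrable (fun y => u y - c) volume t s :=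
    ((intervalIntegrable_iff_integrableOn_Ioc_of_le hts.le).2 hui').sub (by simp)
  have hzero : ∫ y in t..s, (u y - c) = 0 := by
    rw [intervalIntegral.integral_sub ((intervalIntegrable_iff_integrableOn_Ioc_of_le hts.le).2 hui') (by simp)]
    rw [intervalIntegral.integral_const, intervalIntegral.integral_of_le hts.le, hc]
    have : s - t ≠ 0 := by linarith
    rw [smul_eq_mul]
    field_simp
    ring
  have hrew : ∫ y in t..s, Kr ω i x y * (u y - gradedProj n q u y) =
      ∫ y in t..s, (Kr ω i x y - Kr ω i x t) * (u y - c) := by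
    have e1 : ∫ y in t..s, Kr ω i x y * (u y - gradedProj n q u y) = ∫ y in t..s, Kr ω i x y * (u y - c) := by
      rw [intervalIntegral.integral_of_le hts.le, intervalIntegral.integral_of_le hts.le]
      refine setIntegral_congr_fun measurableSet_Ioc (fun y hy => ?_)
      rw [hpe y hy]
    have e2 : ∫ y in t..s, (Kr ω i x y - Kr ω i x t) * (u y - c) =
        (∫ y in t..s, Kr ω i x y * (u y - c)) - ∫ y in t..s, Kr ω i x t * (u y - c) := by
      rw [← intervalIntegral.integral_sub (huI.continuousOn_mul hKc) (huI.const_mul _)]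
      congr 1
      ext y
      ring
    rw [e1, e2, intervalIntegral.integral_const_mul, hzero, mul_zero, sub_zero]
  rw [hrew, ← intervalIntegral.integral_const_mul, ← Real.norm_eq_abs]
  refine intervalIntegral.norm_integral_le_of_norm_le hts.le
    (Filter.Eventually.of_forall (fun y hy => ?_)) ((rpow_ii hx ht.le hts.le).const_mul _)
  rw [Real.norm_eq_abs, abs_mul]
  have k1 := Kr_lip h hx ht.le hy.1.le i
  have k2 := hvb y hy
  have hxt : 0 < x + t := by linarith
  have hxy : 0 < x + y := by linarith [hy.1]
  have k3 : y - t ≤ P := by linarith [hy.2]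
  have k4 := Real.rpow_nonneg ht.le (α - 1)
  have k5 : a ^ (q - 1) * a ^ (q - 1) * t ^ (α - 1) = t ^ (1 + (α - 2 / q)) := by
    rw [hta, ← Real.rpow_mul ha.le, ← Real.rpow_mul ha.le, ← Real.rpow_add ha, ← Real.rpow_add ha]
    congr 1
    field_simp
    ring
  have k6 : t ^ (1 + (α - 2 / q)) ≤ (x + t) ^ (1 + (α - 2 / q)) :=
    Real.rpow_le_rpow ht.le (by linarith) (by linarith)
  have k7 : (x + t) ^ (1 + (α - 2 / q)) * ((x + t) ^ (i + 2))⁻¹ = (x + t) ^ (α - 2 / q - 1 - i) := by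
    rw [← Real.rpow_natCast, ← Real.rpow_neg hxt.le, ← Real.rpow_add hxt]
    congr 1
    push_cast
    ring
  have h2q : (0 : ℝ) < 2 ^ (-q) := by positivity
  have k8 : (x + t) ^ (α - 2 / q - 1 - i) ≤ (2 ^ (-q)) ^ (α - 2 / q - 1 - i) * (x + y) ^ (α - 2 / q - 1 - i) := by
    rw [← Real.mul_rpow h2q.le hxy.le]
    refine Real.rpow_le_rpow_of_nonpos (by positivity) ?_ ?_
    · have z1 : (2 : ℝ) ^ (-q) * y ≤ t := by
        rw [Real.rpow_neg (by norm_num), inv_mul_le_iff₀ (by positivity)]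
        exact hy.2.trans hs2
      have z2 : (2 : ℝ) ^ (-q) ≤ 1 := Real.rpow_le_one_of_one_le_of_nonpos (by norm_num) (by linarith)
      nlinarith
    · have : 0 < 2 / q := by positivity
      have : (0 : ℝ) ≤ i := by positivity
      linarith
  calc |Kr ω i x y - Kr ω i x t| * |u y - c|
      ≤ (((i : ℝ) + 1) * ((κ * (x + t)) ^ (i + 2))⁻¹ * P) * (M * t ^ (α - 1) * P) := by
        refine mul_le_mul (k1.trans ?_) k2 (abs_nonneg _) (by positivity)
        gcongr
    _ = (((i : ℝ) + 1) * (κ ^ (i + 2))⁻¹ * (q * 2 ^ (q - 1)) ^ 2 * M * ((n : ℝ) ^ 2)⁻¹) *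
        ((a ^ (q - 1) * a ^ (q - 1) * t ^ (α - 1)) * ((x + t) ^ (i + 2))⁻¹) := by
        rw [hP, mul_pow κ, mul_inv]
        ring
    _ ≤ (((i : ℝ) + 1) * (κ ^ (i + 2))⁻¹ * (q * 2 ^ (q - 1)) ^ 2 * M * ((n : ℝ) ^ 2)⁻¹) *
        ((2 ^ (-q)) ^ (α - 2 / q - 1 - i) * (x + y) ^ (α - 2 / q - 1 - i)) := by
        rw [k5]
        have : t ^ (1 + (α - 2 / q)) * ((x + t) ^ (i + 2))⁻¹ ≤ (x + t) ^ (α - 2 / q - 1 - i) := by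
          rw [← k7]
          gcongr
        exact mul_le_mul_of_nonneg_left (this.trans k8) (by positivity)
    _ = _ := by
        unfold Cint
        ring

theorem W_hasDerivAt {ω : ℂ} {κ : ℝ} (h : GoodW ω κ) {v : ℝ → ℝ} (hv : IntegrableOn v (Set.Ioc 0 1))
    (i : ℕ) {x : ℝ} (hx : 0 < x) :
    HasDerivAt (fun x => ∫ y in Set.Ioc (0 : ℝ) 1, Kr ω i x y * v y)
      (-((i : ℝ) + 1) * ∫ y in Set.Ioc (0 : ℝ) 1, Kr ω (i + 1) x y * v y) x := by
  have hκ := h.pos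
  have hmeas : ∀ (j : ℕ) (z : ℝ), 0 < z →
      AEStronglyMeasurable (fun y => Kr ω j z y * v y) (volume.restrict (Set.Ioc 0 1)) := by
    intro j z hz
    refine AEStronglyMeasurable.mul ?_ hv.aestronglyMeasurable
    exact ((Kr_cont h hz j).mono (fun y hy => hy.1.le)).aestronglyMeasurable measurableSet_Ioc
  have hs : Set.Ioi (x / 2) ∈ nhds x := Ioi_mem_nhds (by linarith)
  have hb : ∀ (j : ℕ) (z y : ℝ), x / 2 < z → y ∈ Set.Ioc (0 : ℝ) 1 →
      |Kr ω j z y| ≤ ((κ * (x / 2)) ^ (j + 1))⁻¹ := by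
    intro j z y hz hy
    refine (Kr_abs h (by linarith) hy.1.le j).trans ?_
    have : 0 < x / 2 := by linarith
    gcongr
    linarith [hy.1]
  have key := hasDerivAt_integral_of_dominated_loc_of_deriv_le (μ := volume.restrict (Set.Ioc (0 : ℝ) 1))
    (F := fun x y => Kr ω i x y * v y) (F' := fun x y => (-((i : ℝ) + 1) * Kr ω (i + 1) x y) * v y)
    (x₀ := x) (s := Set.Ioi (x / 2))
    (bound := fun y => (((i : ℝ) + 1) * ((κ * (x / 2)) ^ (i + 1 + 1))⁻¹) * |v y|) hs ?_ ?_ ?_ ?_ ?_ ?_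
  · refine key.2.congr_deriv ?_
    rw [← integral_const_mul]
    congr 1
    ext y
    ring
  · filter_upwards [hs] with z hz
    have : x / 2 < z := hz
    exact hmeas i z (by linarith)
  · refine Integrable.mono' (hv.norm.const_mul (((κ * (x / 2)) ^ (i + 1))⁻¹)) (hmeas i x hx) ?_
    rw [ae_restrict_iff' measurableSet_Ioc]
    refine Filter.Eventually.of_forall (fun y hy => ?_)
    rw [norm_mul]
    exact mul_le_mul_of_nonneg_right (hb i x y (by linarith) hy) (norm_nonneg _)
  · refine ((hmeas (i + 1) x hx).const_mul (-((i : ℝ) + 1))).congr ?_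
    refine Filter.Eventually.of_forall (fun y => ?_)
    simp only
    ring
  · rw [ae_restrict_iff' measurableSet_Ioc]
    refine Filter.Eventually.of_forall (fun y hy z hz => ?_)
    have := hb (i + 1) z y hz hy
    rw [Real.norm_eq_abs, abs_mul, abs_mul, abs_neg, abs_of_nonneg (by positivity : (0 : ℝ) ≤ (i : ℝ) + 1)]
    gcongr
  · exact (hv.norm.const_mul _)
  · rw [ae_restrict_iff' measurableSet_Ioc]
    refine Filter.Eventually.of_forall (fun y hy z hz => ?_)
    have : x / 2 < z := hz
    exact (Kr_hasDerivAt h (by linarith) hy.1.le i).mul_const _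

theorem iter_eq {ω : ℂ} {κ : ℝ} (h : GoodW ω κ) {v w : ℝ → ℝ} {b : ℝ} (hv : IntegrableOn v (Set.Ioc 0 1))
    (hw : ∀ x ∈ Set.Ioc (0 : ℝ) 1, w x = b * ∫ y in Set.Ioc (0 : ℝ) 1, Kr ω 0 x y * v y) (i : ℕ) :
    ∀ x ∈ Set.Ioc (0 : ℝ) 1, iteratedDerivWithin i w (Set.Ioc 0 1) x =
      b * ((-1) ^ i * (i.factorial : ℝ)) * ∫ y in Set.Ioc (0 : ℝ) 1, Kr ω i x y * v y := by
  induction i with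
  | zero =>
    intro x hx
    simp [hw x hx]
  | succ i ih =>
    intro x hx
    rw [iteratedDerivWithin_succ, derivWithin_congr (s := Set.Ioc 0 1) (fun y hy => ih y hy) (ih x hx)]
    have := ((W_hasDerivAt h hv i hx.1).const_mul (b * ((-1) ^ i * (i.factorial : ℝ))))
    rw [this.hasDerivWithinAt.derivWithin (uniqueDiffOn_Ioc 0 1 x hx)]
    rw [Nat.factorial_succ]
    push_cast
    ring

theorem W_split {ω : ℂ} {κ : ℝ} (h : GoodW ω κ) {x α q M : ℝ} {u : ℝ → ℝ} (hx : 0 < x)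
    (hα0 : 0 < α) (hα1 : α < 1) (hq : 1 ≤ q) (hβ : 0 < α - 2 / q) (hM : 0 ≤ M) (i : ℕ)
    {n : ℕ} (hn : 1 ≤ n) (hui : IntegrableOn u (Set.Ioc 0 1))
    (hH : ∀ y z : ℝ, 0 < z → z ≤ y → y ≤ 1 → |u y - u z| ≤ M / α * (y ^ α - z ^ α)) :
    |∫ y in Set.Ioc (0 : ℝ) 1, Kr ω i x y * (u y - gradedProj n q u y)| ≤
      |∫ y in (0 : ℝ)..(gradedNode n q 1), Kr ω i x y * (u y - gradedProj n q u y)| +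
      Cint κ q (α - 2 / q) i * M * ((n : ℝ) ^ 2)⁻¹ *
        ∫ y in (gradedNode n q 1)..1, (x + y) ^ (α - 2 / q - 1 - i) := by
  have hq0 : 0 < q := by linarith
  have hv : IntegrableOn (fun y => u y - gradedProj n q u y) (Set.Ioc 0 1) :=
    hui.sub (proj_integrable _ (by simp))
  have hvi : IntervalIntegrable (fun y => u y - gradedProj n q u y) volume 0 1 :=
    (intervalIntegrable_iff_integrableOn_Ioc_of_le zero_le_one).2 hv
  have hI : IntervalIntegrable (fun y => Kr ω i x y * (u y - gradedProj n q u y)) volume 0 1 := by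
    refine hvi.continuousOn_mul ((Kr_cont h hx i).mono ?_)
    rw [Set.uIcc_of_le zero_le_one]
    exact fun y hy => hy.1
  have hle : ∀ m, m ≤ n → gradedNode n q m ≤ 1 := fun m hm => by
    rw [← node_n (q := q) hn]
    exact node_le hn hq0 hm
  have hI' : ∀ a b, 0 ≤ a → a ≤ b → b ≤ 1 →
      IntervalIntegrable (fun y => Kr ω i x y * (u y - gradedProj n q u y)) volume a b := by
    intro a b ha hab hb
    refine hI.mono_set ?_
    rw [Set.uIcc_of_le hab, Set.uIcc_of_le zero_le_one]
    exact Set.Icc_subset_Icc ha hb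
  rw [← intervalIntegral.integral_of_le zero_le_one]
  rw [← intervalIntegral.integral_add_adjacent_intervals (b := gradedNode n q 1)
    (hI' _ _ le_rfl node_nonneg (hle 1 hn)) (hI' _ _ node_nonneg (hle 1 hn) le_rfl)]
  refine (abs_add_le _ _).trans (add_le_add le_rfl ?_)
  have e1 := intervalIntegral.sum_integral_adjacent_intervals_Ico (μ := volume)
    (f := fun y => Kr ω i x y * (u y - gradedProj n q u y)) (a := gradedNode n q) hn
    (fun k hk => hI' _ _ node_nonneg (node_mono hn hq0).le (hle _ hk.2))
  have e2 := intervalIntegral.sum_integral_adjacent_intervals_Ico (μ := volume)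
    (f := fun y => (x + y) ^ (α - 2 / q - 1 - i)) (a := gradedNode n q) hn
    (fun k hk => rpow_ii hx node_nonneg (node_mono hn hq0).le)
  rw [node_n hn] at e1 e2
  rw [← e1, ← e2, Finset.mul_sum]
  refine (Finset.abs_sum_le_sum_abs _ _).trans (Finset.sum_le_sum (fun m hm => ?_))
  rw [Finset.mem_Ico] at hm
  exact other_interval h hx hα0 hα1 hq hβ hM i hn hm.1 hm.2 hui hH

theorem node_one_rpow {n : ℕ} {q : ℝ} (hn : 1 ≤ n) (hq : 0 < q) :
    (gradedNode n q 1) ^ (2 / q) = ((n : ℝ) ^ 2)⁻¹ := by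
  unfold gradedNode
  rw [← Real.rpow_mul (by positivity), mul_div_cancel₀ _ hq.ne']
  rw [show (2 : ℝ) = ((2 : ℕ) : ℝ) by norm_num, Real.rpow_natCast]
  simp

theorem W_bound (p α q : ℝ)
    (hp0 : 0 < p) (hp1 : p < 1) (hα0 : 0 < α) (hα1 : α < 1) (hq : 1 ≤ q) (hβ : 0 < α - 2 / q) (i : ℕ) :
    ∃ C : ℝ, 0 ≤ C ∧ ∀ n : ℕ, 1 ≤ n → ∀ u : ℝ → ℝ, ∀ M : ℝ, 0 ≤ M → IntegrableOn u (Set.Ioc 0 1) →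
      ContDiffOn ℝ 4 u (Set.Ioc 0 1) →
      (∀ t ∈ Set.Ioo (0 : ℝ) 1, |deriv u t| ≤ M * t ^ (α - 1)) →
      ∀ x ∈ Set.Ioc (0 : ℝ) 1,
      x ^ max ((i : ℝ) - (α - 2 / q)) 0 * |∫ y in Set.Ioc (0 : ℝ) 1,
        Kr ⟨Real.cos (p * Real.pi), Real.sin (p * Real.pi)⟩ i x y * (u y - gradedProj n q u y)| ≤
        C * ((n : ℝ) ^ 2)⁻¹ * M := by
  have h := goodW_of p hp0 hp1
  set κ := Real.sqrt ((1 + Real.cos (p * Real.pi)) / 2)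
  set ω : ℂ := ⟨Real.cos (p * Real.pi), Real.sin (p * Real.pi)⟩ with hω
  have hκ : 0 < κ := h.pos
  have hk : 0 < 1 + Real.cos (p * Real.pi) := by have := Real.sqrt_pos.1 h.pos; linarith
  have hq0 : 0 < q := by linarith
  have h2q : 0 < 2 / q := by positivity
  have hCint : 0 ≤ Cint κ q (α - 2 / q) i := by unfold Cint; positivity
  rcases Nat.eq_zero_or_pos i with hi | hi
  · refine ⟨2 / (1 + Real.cos (p * Real.pi)) / α + Cint κ q (α - 2 / q) i * (2 / (α - 2 / q)), by positivity, ?_⟩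
    intro n hn u M hM hui hu hd x hx
    have hT0 : 0 < gradedNode n q 1 := by
      have := node_mono (m := 0) hn hq0
      rwa [node_zero hq0] at this
    have hT1 : gradedNode n q 1 ≤ 1 := by
      rw [← node_n (q := q) hn]
      exact node_le hn hq0 hn
    set T := gradedNode n q 1 with hT
    have hTN : T ^ (2 / q) = ((n : ℝ) ^ 2)⁻¹ := node_one_rpow hn hq0
    have hTα : T ^ α ≤ ((n : ℝ) ^ 2)⁻¹ := by
      rw [← hTN]
      exact Real.rpow_le_rpow_of_exponent_ge hT0 hT1 (by linarith)
    have hs := W_split h hx.1 hα0 hα1 hq hβ hM i hn hui (fun y z hz hzy hy => u_holder hα0 hu hd hz hzy hy)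
    have hv : ∀ y ∈ Set.Ioc 0 T, |u y - gradedProj n q u y| ≤ M / α * T ^ α := by
      intro y hy
      have hpe := proj_eq (u := u) (m := 0) (y := y) hn hq0 hn (by rw [node_zero hq0]; exact hy)
      rw [node_zero hq0, zero_add, ← hT] at hpe
      rw [hpe]
      refine avg_bound hT0 (hui.mono_set (Set.Ioc_subset_Ioc_right hT1)) (fun z hz => ?_)
      exact u_holder' hα0 hM hu hd hz.1 (hz.2.trans hT1) hy.1 (hy.2.trans hT1) hy.2 hz.2
    have hf := first_zero hp0 hp1 hx.1 hT0 (by positivity) hv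
    have hr := rpow_int_le' hx.1 hx.2 hT0.le hT1 hβ (by linarith)
    subst hi
    rw [max_eq_right (by push_cast; linarith), Real.rpow_zero, one_mul]
    simp only [Nat.cast_zero, sub_zero] at hs
    refine hs.trans ((add_le_add hf (mul_le_mul_of_nonneg_left hr (by positivity))).trans ?_)
    calc _ ≤ 2 / (1 + Real.cos (p * Real.pi)) * (M / α * ((n : ℝ) ^ 2)⁻¹) + Cint κ q (α - 2 / q) 0 * M * ((n : ℝ) ^ 2)⁻¹ * (2 / (α - 2 / q)) := by gcongr
      _ = _ := by ring
  · have hi1 : (1 : ℝ) ≤ i := by exact_mod_cast hi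
    have hib : 0 < (i : ℝ) - (α - 2 / q) := by linarith
    have hia : 0 < (i : ℝ) - α := by linarith
    refine ⟨((κ ^ (i + 1))⁻¹ / (α * (i - α)) + (κ ^ i)⁻¹ / α + (κ ^ (i + 1))⁻¹ / α) + Cint κ q (α - 2 / q) i * (1 / (i - (α - 2 / q))), by positivity, ?_⟩
    intro n hn u M hM hui hu hd x hx
    have hT0 : 0 < gradedNode n q 1 := by
      have := node_mono (m := 0) hn hq0
      rwa [node_zero hq0] at this
    have hT1 : gradedNode n q 1 ≤ 1 := by
      rw [← node_n (q := q) hn]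
      exact node_le hn hq0 hn
    set T := gradedNode n q 1 with hT
    have hTN : T ^ (2 / q) = ((n : ℝ) ^ 2)⁻¹ := node_one_rpow hn hq0
    have hs := W_split h hx.1 hα0 hα1 hq hβ hM i hn hui (fun y z hz hzy hy => u_holder hα0 hu hd hz hzy hy)
    have hpe : ∀ y ∈ Set.Ioc 0 T, gradedProj n q u y = (T - 0)⁻¹ * ∫ y in Set.Ioc 0 T, u y := by
      intro y hy
      have hpe := proj_eq (u := u) (m := 0) (y := y) hn hq0 hn (by rw [node_zero hq0]; exact hy)
      rwa [node_zero hq0, zero_add, ← hT] at hpe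
    have hH : ∀ y z L : ℝ, 0 < y → y ≤ T → 0 < z → z ≤ T → y ≤ L → z ≤ L → |u y - u z| ≤ M / α * L ^ α :=
      fun y z L hy0 hyT hz0 hzT hyL hzL =>
        u_holder' hα0 hM hu hd hz0 (hzT.trans hT1) hy0 (hyT.trans hT1) hyL hzL
    have huT : IntegrableOn u (Set.Ioc 0 T) := hui.mono_set (Set.Ioc_subset_Ioc_right hT1)
    have hf := first_pos h hx.1 hT0 hα0 hα1 h2q hβ hM hi huT hH
      (c := (T - 0)⁻¹ * ∫ y in Set.Ioc 0 T, u y) (fun y hy =>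
        avg_bound hT0 huT (fun z hz => hH y z T hy.1 hy.2 hz.1 hz.2 hy.2 hz.2))
    have hcongr : ∫ y in (0 : ℝ)..T, Kr ω i x y * (u y - gradedProj n q u y) =
        ∫ y in (0 : ℝ)..T, Kr ω i x y * (u y - (T - 0)⁻¹ * ∫ y in Set.Ioc 0 T, u y) := by
      rw [intervalIntegral.integral_of_le hT0.le, intervalIntegral.integral_of_le hT0.le]
      refine setIntegral_congr_fun measurableSet_Ioc (fun y hy => ?_)
      rw [hpe y hy]
    rw [hcongr] at hs
    have hr := rpow_int_le (r := α - 2 / q - 1 - i) hx.1 hT0.le hT1 (by linarith)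
    rw [show α - 2 / q - 1 - (i : ℝ) + 1 = α - 2 / q - i by ring,
      show -(α - 2 / q - (i : ℝ)) = i - (α - 2 / q) by ring] at hr
    rw [max_eq_left hib.le]
    rw [hTN] at hf
    have hone : x ^ ((i : ℝ) - (α - 2 / q)) * x ^ (α - 2 / q - i) = 1 := by
      rw [← Real.rpow_add hx.1]
      rw [show (i : ℝ) - (α - 2 / q) + (α - 2 / q - i) = 0 by ring, Real.rpow_zero]
    have hxp := Real.rpow_nonneg hx.1.le ((i : ℝ) - (α - 2 / q))
    refine (mul_le_mul_of_nonneg_left (hs.trans (add_le_add hf (mul_le_mul_of_nonneg_left hr (by positivity)))) hxp).trans (le_of_eq ?_)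
    generalize x ^ ((i : ℝ) - (α - 2 / q)) = X at *
    generalize x ^ (α - 2 / q - i) = Y at *
    generalize ((κ ^ (i + 1))⁻¹ / (α * (i - α)) + (κ ^ i)⁻¹ / α + (κ ^ (i + 1))⁻¹ / α) = A at *
    generalize Cint κ q (α - 2 / q) i = B at *
    linear_combination (A * M * ((n : ℝ) ^ 2)⁻¹ + B * M * ((n : ℝ) ^ 2)⁻¹ * (1 / ((i : ℝ) - (α - 2 / q)))) * hone

/-- For `p ∈ (0,1)`, `0 < α < 1/(1+p)`, grading exponent `q > 2/α` and `β = α − 2/q`,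
there is a constant `C > 0`, independent of `n` and `u`, such that for every `u ∈ C⁴_α`
the function `w = K(I − π_h)u` satisfies `‖w‖_{4,β} ≤ C·n⁻²·‖u‖_{4,α}`. -/
theorem cornerErr_weighted_bound_four (p α q : ℝ)
    (hp0 : 0 < p) (hp1 : p < 1) (hα0 : 0 < α) (hα1 : α < 1 / (1 + p))
    (hq : q > 2 / α) :
    ∃ C : ℝ, 0 < C ∧ ∀ n : ℕ, 1 ≤ n → ∀ u : ℝ → ℝ,
      ContDiffOn ℝ 4 u (Set.Ioc 0 1) → BddAbove (weightedSet 4 α u) →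
      BddAbove (weightedSet 4 (α - 2 / q) (cornerErr p q n u)) ∧
      weightedNorm 4 (α - 2 / q) (cornerErr p q n u) ≤
        C * ((n : ℝ) ^ 2)⁻¹ * weightedNorm 4 α u := by
  have hα : α < 1 := hα1.trans_le (by rw [div_le_one (by linarith)]; linarith)
  have hq0 : 0 < q := lt_trans (by positivity) hq
  have hβ : 0 < α - 2 / q := by
    have : 2 / q < α := by
      rw [div_lt_iff₀ hq0]
      have := (div_lt_iff₀ hα0).1 hq
      linarith
    linarith
  have hq1 : 1 ≤ q := by
    have : 2 ≤ 2 / α := by rw [le_div_iff₀ hα0]; linarith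
    linarith
  choose C hC0 hC using fun i => W_bound p α q hp0 hp1 hα0 hα hq1 hβ i
  have hpi := Real.pi_pos
  have hnn : ∀ i ∈ Finset.range 5, 0 ≤ Real.pi⁻¹ * (i.factorial : ℝ) * C i :=
    fun i _ => mul_nonneg (by positivity) (hC0 i)
  have hS := Finset.sum_nonneg hnn
  refine ⟨∑ i ∈ Finset.range 5, Real.pi⁻¹ * (i.factorial : ℝ) * C i + 1, by linarith, ?_⟩
  intro n hn u hu hb
  set M := weightedNorm 4 α u with hMdef
  have hle : ∀ i : ℕ, i ≤ 4 → ∀ t ∈ Set.Ioc (0 : ℝ) 1,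
      t ^ max ((i : ℝ) - α) 0 * |iteratedDerivWithin i u (Set.Ioc 0 1) t| ≤ M :=
    fun i hi t ht => le_csSup hb ⟨i, hi, t, ht, rfl⟩
  have hM : 0 ≤ M := by
    refine le_trans ?_ (hle 0 (by norm_num) 1 (by simp))
    positivity
  have hu0 : ∀ t ∈ Set.Ioc (0 : ℝ) 1, |u t| ≤ M := by
    intro t ht
    have := hle 0 (by norm_num) t ht
    rw [max_eq_right (by push_cast; linarith), Real.rpow_zero, one_mul, iteratedDerivWithin_zero] at this
    exact this
  have hd : ∀ t ∈ Set.Ioo (0 : ℝ) 1, |deriv u t| ≤ M * t ^ (α - 1) := by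
    intro t ht
    have := hle 1 (by norm_num) t ⟨ht.1, ht.2.le⟩
    rw [max_eq_left (by push_cast; linarith), iteratedDerivWithin_one,
      derivWithin_of_mem_nhds (Ioc_mem_nhds ht.1 ht.2)] at this
    push_cast at this
    have hp := Real.rpow_pos_of_pos ht.1 (α - 1)
    have hone : t ^ (1 - α) * t ^ (α - 1) = 1 := by
      rw [← Real.rpow_add ht.1]; simp
    calc |deriv u t| = (t ^ (1 - α) * |deriv u t|) * t ^ (α - 1) := by
          linear_combination (-|deriv u t|) * hone
      _ ≤ _ := by gcongr
  have hui : IntegrableOn u (Set.Ioc 0 1) := by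
    refine Integrable.mono' (g := fun _ => M) (integrableOn_const (by simp))
      (hu.continuousOn.aestronglyMeasurable measurableSet_Ioc) ?_
    rw [ae_restrict_iff' measurableSet_Ioc]
    exact Filter.Eventually.of_forall hu0
  have hv : IntegrableOn (fun y => u y - gradedProj n q u y) (Set.Ioc 0 1) :=
    hui.sub (proj_integrable _ (by simp))
  have hw : ∀ x ∈ Set.Ioc (0 : ℝ) 1, cornerErr p q n u x = Real.pi⁻¹ * ∫ y in Set.Ioc (0 : ℝ) 1,
      Kr ⟨Real.cos (p * Real.pi), Real.sin (p * Real.pi)⟩ 0 x y * (u y - gradedProj n q u y) := by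
    intro x hx
    unfold cornerErr cornerOp
    rw [← integral_const_mul]
    refine setIntegral_congr_fun measurableSet_Ioc (fun y hy => ?_)
    simp only
    rw [cornerKernel_eq p x y hp0 hp1 hx.1 hy.1.le, mul_assoc]
  have hmain : ∀ r ∈ weightedSet 4 (α - 2 / q) (cornerErr p q n u), r ≤
      (∑ i ∈ Finset.range 5, Real.pi⁻¹ * (i.factorial : ℝ) * C i + 1) * ((n : ℝ) ^ 2)⁻¹ * M := by
    rintro r ⟨i, hi, t, ht, rfl⟩
    rw [iter_eq (goodW_of p hp0 hp1) hv hw i t ht]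
    have hb := hC i n hn u M hM hui hu hd t ht
    have hsi : Real.pi⁻¹ * (i.factorial : ℝ) * C i ≤ ∑ i ∈ Finset.range 5, Real.pi⁻¹ * (i.factorial : ℝ) * C i :=
      Finset.single_le_sum (f := fun i => Real.pi⁻¹ * (i.factorial : ℝ) * C i) hnn (Finset.mem_range.2 (by omega))
    have habs : |Real.pi⁻¹ * ((-1) ^ i * (i.factorial : ℝ))| = Real.pi⁻¹ * (i.factorial : ℝ) := by
      rw [abs_mul, abs_mul, abs_pow, abs_neg, abs_one, one_pow, one_mul, abs_of_pos (by positivity),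
        abs_of_nonneg (by positivity)]
    rw [abs_mul, habs]
    calc _ = (Real.pi⁻¹ * (i.factorial : ℝ)) * (t ^ max ((i : ℝ) - (α - 2 / q)) 0 * |∫ y in Set.Ioc (0 : ℝ) 1,
        Kr ⟨Real.cos (p * Real.pi), Real.sin (p * Real.pi)⟩ i t y * (u y - gradedProj n q u y)|) := by ring
      _ ≤ (Real.pi⁻¹ * (i.factorial : ℝ)) * (C i * ((n : ℝ) ^ 2)⁻¹ * M) := by gcongr
      _ = (Real.pi⁻¹ * (i.factorial : ℝ) * C i) * ((n : ℝ) ^ 2)⁻¹ * M := by ring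
      _ ≤ _ := by
        refine mul_le_mul_of_nonneg_right (mul_le_mul_of_nonneg_right ?_ (by positivity)) hM
        linarith
  refine ⟨⟨_, hmain⟩, ?_⟩
  refine csSup_le ?_ hmain
  exact ⟨_, 0, by norm_num, 1, by simp, rfl⟩
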